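/- arXiv:1906.06817 — 2 statements merged into one kernel-verified Lean document; each statement's English description precedes it below -/
import Mathlib

section
/- Let R = K[x_{ij} : 1 ≤ i ≤ m, 1 ≤ j ≤ n] and fix a diagonal term order σ. For the ideal I_t(X) of t-minors of the generic m × n matrix X, the initial ideal in(I_t(X)) is generated by the products of the main diagonal entries of the t × t submatrices of X, i.e., the monomials x_{i_1 j_1} x_{i_2 j_2} ⋯ x_{i_t j_t} with i_1 < ⋯ < i_t and j_1 < ⋯ < j_t. -/
/-! Statement 14: for the generic m × n matrix X (the case r = 1), the initial
ideal of the determinantal ideal I_t(X) under any diagonal term order is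
generated by the main-diagonal monomials of the t × t submatrices of X. -/

open MvPolynomial

noncomputable section

/-- A term order on monomials (exponent vectors) in variables indexed by `σ`. -/
structure TermOrder (σ : Type*) where
  lt : (σ →₀ ℕ) → (σ →₀ ℕ) → Prop
  trans : ∀ {a b c}, lt a b → lt b c → lt a c
  irrefl : ∀ a, ¬ lt a a
  total : ∀ a b, a ≠ b → lt a b ∨ lt b a
  zero_lt : ∀ a, a ≠ 0 → lt 0 a
  add_right : ∀ a b c, lt a b → lt (a + c) (b + c)

/-- `m` is the leading monomial of `f` with respect to the term order `tord`. -/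
def IsLeadMono {σ K : Type*} [Field K] (tord : TermOrder σ) (f : MvPolynomial σ K)
    (m : σ →₀ ℕ) : Prop :=
  m ∈ f.support ∧ ∀ m' ∈ f.support, m' ≠ m → tord.lt m' m

/-- The initial ideal of `I` with respect to the term order `tord`. -/
def initialIdeal {σ K : Type*} [Field K] (tord : TermOrder σ) (I : Ideal (MvPolynomial σ K)) :
    Ideal (MvPolynomial σ K) :=
  Ideal.span {g | ∃ f ∈ I, ∃ m, IsLeadMono tord f m ∧ g = monomial m (1 : K)}

/-- `G` is a Gröbner basis of `I` with respect to `tord`. -/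
def IsGroebnerBasis {σ K : Type*} [Field K] (tord : TermOrder σ)
    (I : Ideal (MvPolynomial σ K)) (G : Set (MvPolynomial σ K)) : Prop :=
  G ⊆ (I : Set (MvPolynomial σ K)) ∧ Ideal.span G = I ∧
    initialIdeal tord I = Ideal.span {g | ∃ f ∈ G, ∃ m, IsLeadMono tord f m ∧ g = monomial m (1 : K)}

/-- The set of `t × t` minors of a matrix. -/
def minorsSet {A : Type*} [CommRing A] (t a b : ℕ) (M : Matrix (Fin a) (Fin b) A) : Set A :=
  {d | ∃ (rs : Fin t → Fin a) (cs : Fin t → Fin b),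
    StrictMono rs ∧ StrictMono cs ∧ d = (M.submatrix rs cs).det}

/-- The variable in row `i`, column `k` of the horizontal concatenation
`H = (X_1 ⋯ X_r)` of `r` generic `m × n` matrices. -/
def varH (r m n : ℕ) (hn : 0 < n) (i : Fin m) (k : Fin (r * n)) :
    Fin r × Fin m × Fin n :=
  (⟨k.val / n, by
      have := k.isLt
      exact (Nat.div_lt_iff_lt_mul hn).mpr this⟩, i, ⟨k.val % n, Nat.mod_lt _ hn⟩)

/-- The variable in row `k`, column `j` of the vertical concatenation
`V` of `r` generic `m × n` matrices. -/
def varV (r m n : ℕ) (hm : 0 < m) (k : Fin (r * m)) (j : Fin n) :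
    Fin r × Fin m × Fin n :=
  (⟨k.val / m, by
      have := k.isLt
      exact (Nat.div_lt_iff_lt_mul hm).mpr this⟩, ⟨k.val % m, Nat.mod_lt _ hm⟩, j)

/-- The horizontal concatenation `H` as a matrix of polynomials. -/
def Hmat (K : Type*) [Field K] (r m n : ℕ) (hn : 0 < n) :
    Matrix (Fin m) (Fin (r * n)) (MvPolynomial (Fin r × Fin m × Fin n) K) :=
  Matrix.of fun i k => X (varH r m n hn i k)

/-- The vertical concatenation `V` as a matrix of polynomials. -/
def Vmat (K : Type*) [Field K] (r m n : ℕ) (hm : 0 < m) :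
    Matrix (Fin (r * m)) (Fin n) (MvPolynomial (Fin r × Fin m × Fin n) K) :=
  Matrix.of fun k j => X (varV r m n hm k j)

/-- `tord` is a diagonal term order for the matrix of variables `v`: the leading
monomial of the determinant of every square submatrix (with strictly increasing
rows and columns) is the product of its main diagonal entries. -/
def IsDiagonalFor (K : Type*) [Field K] {σ : Type*} (tord : TermOrder σ) {a b : ℕ}
    (v : Fin a → Fin b → σ) : Prop :=
  ∀ (t : ℕ) (rs : Fin t → Fin a) (cs : Fin t → Fin b), StrictMono rs → StrictMono cs →
    0 < t →
    IsLeadMono tord ((Matrix.of fun i j => (X (v (rs i) (cs j)) : MvPolynomial σ K)).det)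
      (∑ i : Fin t, Finsupp.single (v (rs i) (cs i)) 1)

/-- A term order is diagonal for the double determinantal configuration if it is
diagonal for both the horizontal and the vertical concatenation. -/
def IsDiagonalTermOrder (K : Type*) [Field K] (r m n : ℕ) (hm : 0 < m) (hn : 0 < n)
    (tord : TermOrder (Fin r × Fin m × Fin n)) : Prop :=
  IsDiagonalFor K tord (fun i k => varH r m n hn i k) ∧
    IsDiagonalFor K tord (fun k j => varV r m n hm k j)

/-- The double determinantal ideal `J = I_s(H) + I_t(V)`. -/
def doubleDetIdeal (K : Type*) [Field K] (r m n s t : ℕ) (hm : 0 < m) (hn : 0 < n) :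
    Ideal (MvPolynomial (Fin r × Fin m × Fin n) K) :=
  Ideal.span (minorsSet s m (r * n) (Hmat K r m n hn) ∪ minorsSet t (r * m) n (Vmat K r m n hm))

section Helpers

set_option linter.unusedSectionVars false

theorem chain_or_color {σ : Type*} [DecidableEq σ] (lt : σ → σ → Prop)
    (htr : ∀ x y z, lt x y → lt y z → lt x z) (r : ℕ) :
    ∀ S : Finset σ, (∃ g : Fin (r + 1) → σ, (∀ i, g i ∈ S) ∧ ∀ i j, i < j → lt (g i) (g j)) ∨
      ∃ c : σ → ℕ, (∀ p ∈ S, c p < r) ∧ ∀ p ∈ S, ∀ q ∈ S, c p = c q → ¬ lt p q := by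
  classical
  induction r with
  | zero =>
    intro S
    rcases S.eq_empty_or_nonempty with rfl | ⟨p, hp⟩
    · right; exact ⟨fun _ => 0, by simp, by simp⟩
    · left
      refine ⟨fun _ => p, fun _ => hp, ?_⟩
      intro i j hij
      exact absurd hij (by omega)
  | succ r ih =>
    intro S
    rcases ih (S.filter fun p => ∃ q ∈ S, lt q p) with ⟨g, hg, hlt⟩ | ⟨c, hc, hlt⟩
    · left
      obtain ⟨q, hq, hq0⟩ := (Finset.mem_filter.1 (hg 0)).2
      refine ⟨Fin.cons q g, ?_, ?_⟩
      · intro i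
        refine Fin.cases ?_ (fun i => ?_) i
        · simpa using hq
        · simpa using (Finset.mem_filter.1 (hg i)).1
      · intro i j
        refine Fin.cases ?_ (fun i => ?_) i
        · refine Fin.cases ?_ (fun j => ?_) j
          · intro h; exact absurd h (lt_irrefl _)
          · intro _
            simp only [Fin.cons_zero, Fin.cons_succ]
            rcases Fin.eq_zero_or_eq_succ j with rfl | ⟨j', rfl⟩
            · exact hq0
            · exact htr _ _ _ hq0 (hlt _ _ (Fin.succ_pos _))
        · refine Fin.cases ?_ (fun j => ?_) j
          · intro h; exact absurd h (by simp)
          · intro h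
            simpa using hlt i j (by simpa using h)
    · right
      refine ⟨fun p => if p ∈ S.filter (fun p => ∃ q ∈ S, lt q p) then c p else r, ?_, ?_⟩
      · intro p hp
        dsimp only
        split_ifs with h
        · exact Nat.lt_succ_of_lt (hc p h)
        · exact Nat.lt_succ_self r
      · intro p hp q hq heq hpq
        have hqf : q ∈ S.filter (fun p => ∃ q ∈ S, lt q p) :=
          Finset.mem_filter.2 ⟨hq, p, hp, hpq⟩
        dsimp only at heq
        rw [if_pos hqf] at heq
        split_ifs at heq with h
        · exact hlt p h q hqf heq hpq
        · have := hc q hqf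
          omega

variable {σ : Type*} [Fintype σ] [DecidableEq σ] {a b : ℕ}

structure Coord (v : Fin a → Fin b → σ) (row : σ → Fin a) (col : σ → Fin b) : Prop where
  hr : ∀ i j, row (v i j) = i
  hc : ∀ i j, col (v i j) = j
  hv : ∀ p, v (row p) (col p) = p

def rowM (v : Fin a → Fin b → σ) (x : σ →₀ ℕ) (i : Fin a) : ℕ := ∑ j, x (v i j)
def colM (v : Fin a → Fin b → σ) (x : σ →₀ ℕ) (j : Fin b) : ℕ := ∑ i, x (v i j)


theorem rowM_add (v : Fin a → Fin b → σ) (x y : σ →₀ ℕ) :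
    rowM v (x + y) = rowM v x + rowM v y := by
  funext i; simp [rowM, Finset.sum_add_distrib]


theorem colM_add (v : Fin a → Fin b → σ) (x y : σ →₀ ℕ) :
    colM v (x + y) = colM v x + colM v y := by
  funext i; simp [colM, Finset.sum_add_distrib]


theorem rowM_single {v : Fin a → Fin b → σ} {row : σ → Fin a} {col : σ → Fin b}
    (h : Coord v row col) (p : σ) (n : ℕ) (i : Fin a) :
    rowM v (Finsupp.single p n) i = if row p = i then n else 0 := by
  unfold rowM
  split_ifs with hi
  · subst hi
    rw [Finset.sum_eq_single (col p)]
    · simp [h.hv]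
    · intro j _ hj
      rw [Finsupp.single_apply, if_neg]
      intro hp
      exact hj (by rw [hp, h.hc])
    · simp
  · apply Finset.sum_eq_zero
    intro j _
    rw [Finsupp.single_apply, if_neg]
    intro hp
    exact hi (by rw [hp, h.hr])


theorem colM_single {v : Fin a → Fin b → σ} {row : σ → Fin a} {col : σ → Fin b}
    (h : Coord v row col) (p : σ) (n : ℕ) (i : Fin b) :
    colM v (Finsupp.single p n) i = if col p = i then n else 0 := by
  unfold colM
  split_ifs with hi
  · subst hi
    rw [Finset.sum_eq_single (row p)]
    · simp [h.hv]
    · intro j _ hj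
      rw [Finsupp.single_apply, if_neg]
      intro hp
      exact hj (by rw [hp, h.hr])
    · simp
  · apply Finset.sum_eq_zero
    intro j _
    rw [Finsupp.single_apply, if_neg]
    intro hp
    exact hi (by rw [hp, h.hc])

/-- support contains no strictly increasing pair -/
def Anti (row : σ → Fin a) (col : σ → Fin b) (x : σ →₀ ℕ) : Prop :=
  ∀ p q, x p ≠ 0 → x q ≠ 0 → ¬ (row p < row q ∧ col p < col q)


theorem anti_aux {v : Fin a → Fin b → σ} {row : σ → Fin a} {col : σ → Fin b}
    (h : Coord v row col) {x y : σ →₀ ℕ} (hy : Anti row col y)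
    (hR : rowM v x = rowM v y) (hC : colM v x = colM v y) (i : Fin a) (j : Fin b)
    (hi : ∀ i' < i, ∀ j', x (v i' j') = y (v i' j'))
    (hj : ∀ j', j < j' → x (v i j') = y (v i j')) : x (v i j) ≤ y (v i j) := by
  by_contra! hlt
  have h1 : ∃ j1, x (v i j1) < y (v i j1) := by
    by_contra! hge
    have := Finset.sum_lt_sum (s := Finset.univ) (f := fun j => y (v i j))
      (g := fun j => x (v i j)) (fun j _ => hge j) ⟨j, Finset.mem_univ _, hlt⟩
    have h2 := congrFun hR i
    simp only [rowM] at h2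
    omega
  have h2 : ∃ i1, x (v i1 j) < y (v i1 j) := by
    by_contra! hge
    have := Finset.sum_lt_sum (s := Finset.univ) (f := fun i => y (v i j))
      (g := fun i => x (v i j)) (fun j _ => hge j) ⟨i, Finset.mem_univ _, hlt⟩
    have h2 := congrFun hC j
    simp only [colM] at h2
    omega
  obtain ⟨j1, h1⟩ := h1
  obtain ⟨i1, h2⟩ := h2
  have hj1 : j1 < j := by
    rcases lt_trichotomy j1 j with h | h | h
    · exact h
    · subst h; omega
    · have := hj j1 h; omega
  have hi1 : i < i1 := by
    rcases lt_trichotomy i i1 with h | h | h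
    · exact h
    · subst h; omega
    · have := hi i1 h j; omega
  refine hy (v i j1) (v i1 j) (by omega) (by omega) ?_
  simp [h.hr, h.hc, hj1, hi1]


theorem anti_unique {v : Fin a → Fin b → σ} {row : σ → Fin a} {col : σ → Fin b}
    (h : Coord v row col) {x y : σ →₀ ℕ} (hx : Anti row col x) (hy : Anti row col y)
    (hR : rowM v x = rowM v y) (hC : colM v x = colM v y) : x = y := by
  have key : ∀ i : Fin a, ∀ j, x (v i j) = y (v i j) := by
    intro i
    induction i using WellFoundedLT.induction with
    | ind i ih =>
      intro j
      induction j using WellFoundedGT.induction with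
      | ind j ih2 =>
        apply le_antisymm
        · exact anti_aux h hy hR hC i j ih (fun j' hj => ih2 j' hj)
        · exact anti_aux h hx hR.symm hC.symm i j (fun i' hi j' => (ih i' hi j').symm)
            (fun j' hj => (ih2 j' hj).symm)
  ext p
  rw [← h.hv p]
  exact key _ _

variable {K : Type*} [Field K] {tord : TermOrder σ}


theorem swap_lt {v : Fin a → Fin b → σ} {row : σ → Fin a} {col : σ → Fin b}
    (h : Coord v row col) (hd : IsDiagonalFor K tord v) {p q : σ}
    (h1 : row p < row q) (h2 : col p < col q) :
    tord.lt (Finsupp.single (v (row p) (col q)) 1 + Finsupp.single (v (row q) (col p)) 1)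
      (Finsupp.single p 1 + Finsupp.single q 1) := by
  have h3 := hd 2 ![row p, row q] ![col p, col q]
    (by intro i j hij; fin_cases i <;> fin_cases j <;> simp_all)
    (by intro i j hij; fin_cases i <;> fin_cases j <;> simp_all) (by norm_num)
  rw [Matrix.det_fin_two] at h3
  simp only [Fin.sum_univ_two, Matrix.of_apply, Matrix.cons_val_zero, Matrix.cons_val_one,
    h.hv] at h3
  have hp1 : v (row p) (col q) ≠ p := fun e => by
    have := congrArg col e
    rw [h.hc] at this
    exact h2.ne' this
  have hp2 : v (row q) (col p) ≠ p := fun e => by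
    have := congrArg row e
    rw [h.hr] at this
    exact h1.ne' this
  have hne : (Finsupp.single (v (row p) (col q)) 1 + Finsupp.single (v (row q) (col p)) 1 : σ →₀ ℕ)
      ≠ Finsupp.single p 1 + Finsupp.single q 1 := by
    intro e
    have := DFunLike.congr_fun e p
    simp [Finsupp.single_apply, hp1, hp2] at this
    omega
  refine h3.2 _ ?_ hne
  have e1 : (X p * X q : MvPolynomial σ K) =
      monomial (Finsupp.single p 1 + Finsupp.single q 1) 1 := by
    simp [X, monomial_mul]
  have e2 : (X (v (row p) (col q)) * X (v (row q) (col p)) : MvPolynomial σ K) =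
      monomial (Finsupp.single (v (row p) (col q)) 1 + Finsupp.single (v (row q) (col p)) 1) 1 := by
    simp [X, monomial_mul]
  rw [e1, e2, mem_support_iff, coeff_sub, coeff_monomial, coeff_monomial, if_neg hne.symm,
    if_pos rfl]
  simp


theorem exists_swap_lt {v : Fin a → Fin b → σ} {row : σ → Fin a} {col : σ → Fin b}
    (h : Coord v row col) (hd : IsDiagonalFor K tord v) {x : σ →₀ ℕ} (hx : ¬ Anti row col x) :
    ∃ y, rowM v y = rowM v x ∧ colM v y = colM v x ∧ tord.lt y x := by
  unfold Anti at hx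
  push Not at hx
  obtain ⟨p, q, hp, hq, h1, h2⟩ := hx
  have hpq : p ≠ q := fun e => by subst e; exact lt_irrefl _ h1
  have hle : Finsupp.single p 1 + Finsupp.single q 1 ≤ x := by
    intro z
    simp only [Finsupp.add_apply, Finsupp.single_apply]
    by_cases e1 : p = z
    · subst e1
      rw [if_pos rfl, if_neg (Ne.symm hpq)]
      omega
    · rw [if_neg e1]
      split_ifs with e2
      · subst e2; omega
      · omega
  obtain ⟨c, rfl⟩ := exists_add_of_le hle
  refine ⟨Finsupp.single (v (row p) (col q)) 1 + Finsupp.single (v (row q) (col p)) 1 + c,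
    ?_, ?_, tord.add_right _ _ _ (swap_lt h hd h1 h2)⟩
  · rw [rowM_add, rowM_add, rowM_add, rowM_add]
    funext i
    simp [rowM_single h, h.hr]
  · rw [colM_add, colM_add, colM_add, colM_add]
    funext i
    simp [colM_single h, h.hc]
    omega


theorem le_rowM {v : Fin a → Fin b → σ} {row : σ → Fin a} {col : σ → Fin b}
    (h : Coord v row col) (x : σ →₀ ℕ) (p : σ) : x p ≤ rowM v x (row p) := by
  have := Finset.single_le_sum (s := Finset.univ) (f := fun j => x (v (row p) j))
    (fun _ _ => Nat.zero_le _) (Finset.mem_univ (col p))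
  simp only [h.hv] at this
  exact this

theorem anti_min {v : Fin a → Fin b → σ} {row : σ → Fin a} {col : σ → Fin b}
    (h : Coord v row col) (hd : IsDiagonalFor K tord v) {x y : σ →₀ ℕ} (hx : Anti row col x)
    (hR : rowM v y = rowM v x) (hC : colM v y = colM v x) : y = x ∨ tord.lt x y := by
  let S : Set (σ →₀ ℕ) := {y | rowM v y = rowM v x ∧ colM v y = colM v x}
  have hS : S.Finite := by
    refine (Set.finite_Iic (Finsupp.equivFunOnFinite.symm fun p => rowM v x (row p))).subset ?_
    rintro z ⟨hz, -⟩ p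
    simpa [hz] using le_rowM h z p
  have : IsStrictOrder (σ →₀ ℕ) tord.lt :=
    { irrefl := tord.irrefl, trans := fun _ _ _ => tord.trans }
  have hwf : S.WellFoundedOn tord.lt := hS.wellFoundedOn
  have hy : y ∈ S := ⟨hR, hC⟩
  clear hR hC
  refine hwf.induction (P := fun y => y = x ∨ tord.lt x y) hy ?_
  · intro y hy ih
    by_cases ha : Anti row col y
    · left; exact anti_unique h ha hx hy.1 hy.2
    · right
      obtain ⟨z, hz1, hz2, hz⟩ := exists_swap_lt h hd ha
      rcases ih z ⟨hz1.trans hy.1, hz2.trans hy.2⟩ hz with rfl | h'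
      · exact hz
      · exact tord.trans h' hz

theorem anti_min_sum {ι : Type*} {v : Fin a → Fin b → σ} {row : σ → Fin a} {col : σ → Fin b}
    (h : Coord v row col) (hd : IsDiagonalFor K tord v) {x y : ι → σ →₀ ℕ}
    (hx : ∀ k, Anti row col (x k))
    (hR : ∀ k, rowM v (y k) = rowM v (x k)) (hC : ∀ k, colM v (y k) = colM v (x k))
    (s : Finset ι) :
    (∀ k ∈ s, y k = x k) ∨ tord.lt (∑ k ∈ s, x k) (∑ k ∈ s, y k) := by
  classical
  induction s using Finset.induction_on with
  | empty => simp
  | insert k s hk ih =>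
    rw [Finset.sum_insert hk, Finset.sum_insert hk]
    rcases anti_min h hd (hx k) (hR k) (hC k) with e | e
    · rcases ih with f | f
      · left; simpa [e] using f
      · right; rw [e, add_comm (x k), add_comm (x k)]; exact tord.add_right _ _ _ f
    · right
      rcases ih with f | f
      · rw [Finset.sum_congr rfl f]; exact tord.add_right _ _ _ e
      · refine tord.trans (tord.add_right _ _ _ e) ?_
        rw [add_comm (y k), add_comm (y k)]; exact tord.add_right _ _ _ f

variable {r : ℕ}

def theta (K : Type*) [Field K] (σ : Type*) (r : ℕ) :
    MvPolynomial σ K →ₐ[K] MvPolynomial (Fin r × σ) K :=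
  aeval fun p => ∑ k : Fin r, X (k, p)

def psiE (r : ℕ) (row : σ → Fin a) (col : σ → Fin b) (q : Fin r × σ) :
    (Fin a × Fin r) ⊕ (Fin r × Fin b) →₀ ℕ :=
  Finsupp.single (Sum.inl (row q.2, q.1)) 1 + Finsupp.single (Sum.inr (q.1, col q.2)) 1

def psi (K : Type*) [Field K] (r : ℕ) (row : σ → Fin a) (col : σ → Fin b) :
    MvPolynomial (Fin r × σ) K →ₐ[K] MvPolynomial ((Fin a × Fin r) ⊕ (Fin r × Fin b)) K :=
  aeval fun q => monomial (psiE r row col q) 1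

def slice (x : Fin r × σ →₀ ℕ) (k : Fin r) : σ →₀ ℕ :=
  Finsupp.equivFunOnFinite.symm fun p => x (k, p)

theorem slice_apply (x : Fin r × σ →₀ ℕ) (k : Fin r) (p : σ) : slice x k p = x (k, p) := rfl

theorem weight_eq_sum_slice (x : Fin r × σ →₀ ℕ) :
    Finsupp.weight (fun q : Fin r × σ => (Finsupp.single q.2 1 : σ →₀ ℕ)) x = ∑ k, slice x k := by
  ext p
  rw [Finsupp.weight_apply, Finsupp.sum_fintype _ _ (by simp), Fintype.sum_prod_type,
    Finsupp.finsetSum_apply, Finsupp.finsetSum_apply]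
  refine Finset.sum_congr rfl fun k _ => ?_
  rw [Finsupp.finsetSum_apply]
  simp [Finsupp.single_apply, slice_apply]

theorem theta_monomial_homog (x : σ →₀ ℕ) (s : K) :
    IsWeightedHomogeneous (fun q : Fin r × σ => (Finsupp.single q.2 1 : σ →₀ ℕ))
      (theta K σ r (monomial x s)) x := by
  rw [theta, aeval_monomial]
  have h1 := IsWeightedHomogeneous.prod (R := K)
    (w := fun q : Fin r × σ => (Finsupp.single q.2 1 : σ →₀ ℕ)) x.support
    (fun p => (∑ k : Fin r, X (k, p)) ^ x p) (fun p => x p • Finsupp.single p 1) (by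
      intro p _
      apply IsWeightedHomogeneous.pow
      apply IsWeightedHomogeneous.sum
      intro k _
      exact isWeightedHomogeneous_X K (fun q : Fin r × σ => (Finsupp.single q.2 1 : σ →₀ ℕ)) (k, p))
  have h2 : ∑ p ∈ x.support, x p • Finsupp.single p 1 = x := by
    conv_rhs => rw [← Finsupp.sum_single x]
    simp [Finsupp.sum]
  rw [h2] at h1
  exact h1.C_mul s

theorem total_mem_support (f : MvPolynomial σ K) (x : Fin r × σ →₀ ℕ)
    (hx : coeff x (theta K σ r f) ≠ 0) : ∑ k, slice x k ∈ f.support := by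
  rw [f.as_sum, map_sum, coeff_sum] at hx
  obtain ⟨y, hy, hne⟩ := Finset.exists_ne_zero_of_sum_ne_zero hx
  have := theta_monomial_homog (r := r) y (coeff y f) hne
  rw [weight_eq_sum_slice] at this
  rwa [this]

theorem psi_monomial (row : σ → Fin a) (col : σ → Fin b) (x : Fin r × σ →₀ ℕ) (s : K) :
    psi K r row col (monomial x s) = monomial (Finsupp.weight (psiE r row col) x) s := by
  rw [psi, aeval_monomial, Finsupp.weight_apply, Finsupp.prod, Finsupp.sum,
    monomial_sum_index]
  simp [monomial_pow, algebraMap_eq]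

theorem weight_inl {v : Fin a → Fin b → σ} {row : σ → Fin a} {col : σ → Fin b}
    (h : Coord v row col) (x : Fin r × σ →₀ ℕ) (i : Fin a) (k : Fin r) :
    Finsupp.weight (psiE r row col) x (Sum.inl (i, k)) = rowM v (slice x k) i := by
  induction x using Finsupp.induction_linear with
  | zero => simp [rowM, slice_apply]
  | add x y hx hy =>
    rw [map_add, Finsupp.add_apply, hx, hy]
    simp [rowM, slice_apply, Finset.sum_add_distrib]
  | single q n =>
    have : slice (Finsupp.single q n) k = if q.1 = k then Finsupp.single q.2 n else 0 := by
      ext p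
      rw [slice_apply]
      split_ifs with e <;> simp [Finsupp.single_apply, Prod.ext_iff, e]
    rw [this, Finsupp.weight_single]
    by_cases e : q.1 = k
    · rw [if_pos e, rowM_single h]
      simp [psiE, Finsupp.single_apply, e]
    · rw [if_neg e]
      simp [psiE, Finsupp.single_apply, e, rowM]

theorem weight_inr {v : Fin a → Fin b → σ} {row : σ → Fin a} {col : σ → Fin b}
    (h : Coord v row col) (x : Fin r × σ →₀ ℕ) (j : Fin b) (k : Fin r) :
    Finsupp.weight (psiE r row col) x (Sum.inr (k, j)) = colM v (slice x k) j := by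
  induction x using Finsupp.induction_linear with
  | zero => simp [colM, slice_apply]
  | add x y hx hy =>
    rw [map_add, Finsupp.add_apply, hx, hy]
    simp [colM, slice_apply, Finset.sum_add_distrib]
  | single q n =>
    have : slice (Finsupp.single q n) k = if q.1 = k then Finsupp.single q.2 n else 0 := by
      ext p
      rw [slice_apply]
      split_ifs with e <;> simp [Finsupp.single_apply, Prod.ext_iff, e]
    rw [this, Finsupp.weight_single]
    by_cases e : q.1 = k
    · rw [if_pos e, colM_single h]
      simp [psiE, Finsupp.single_apply, e]
    · rw [if_neg e]
      simp [psiE, Finsupp.single_apply, e, colM]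

theorem color_inj (c : σ → Fin r) : Function.Injective (fun p => (c p, p)) :=
  fun _ _ e => (Prod.ext_iff.1 e).2

theorem coeff_theta (c : σ → Fin r) (f : MvPolynomial σ K) (m : σ →₀ ℕ) :
    coeff (m.mapDomain fun p => (c p, p)) (theta K σ r f) = coeff m f := by
  rw [← coeff_killCompl (color_inj c)]
  congr 1
  have : (killCompl (color_inj c)).comp (theta K σ r) = AlgHom.id K _ := by
    apply algHom_ext
    intro p
    have hX : ∀ k, killCompl (R := K) (color_inj c) (X (k, p)) = if k = c p then X p else 0 := by
      intro k
      split_ifs with e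
      · subst e
        have := killCompl_rename_app (R := K) (color_inj c) (X p)
        rwa [rename_X] at this
      · rw [killCompl, aeval_X, dif_neg]
        rintro ⟨q, hq⟩
        simp only [Prod.mk.injEq] at hq
        exact e (by rw [← hq.1, hq.2])
    simp [theta, hX]
  exact AlgHom.congr_fun this f

theorem slice_color (c : σ → Fin r) (m : σ →₀ ℕ) (k : Fin r) (p : σ) :
    slice (m.mapDomain fun p => (c p, p)) k p = if c p = k then m p else 0 := by
  rw [slice_apply]
  split_ifs with e
  · subst e
    exact Finsupp.mapDomain_apply (color_inj c) m p
  · apply Finsupp.mapDomain_of_notMem_range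
    rintro ⟨q, hq⟩
    simp only [Prod.mk.injEq] at hq
    exact e (by rw [← hq.1, hq.2])

theorem psi_theta_ne {v : Fin a → Fin b → σ} {row : σ → Fin a} {col : σ → Fin b}
    (h : Coord v row col) (hd : IsDiagonalFor K tord v) {f : MvPolynomial σ K} {m : σ →₀ ℕ}
    (hm : IsLeadMono tord f m) (c : σ → Fin r)
    (hc : ∀ p q, m p ≠ 0 → m q ≠ 0 → c p = c q → ¬ (row p < row q ∧ col p < col q)) :
    psi K r row col (theta K σ r f) ≠ 0 := by
  intro h0
  set mm := m.mapDomain fun p => (c p, p) with hmm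
  have hsum : ∑ k, slice mm k = m := by
    ext p
    rw [Finsupp.finsetSum_apply]
    simp [hmm, slice_color]
  have hanti : ∀ k, Anti row col (slice mm k) := by
    intro k p q hp hq
    rw [hmm, slice_color] at hp hq
    by_cases e1 : c p = k
    · by_cases e2 : c q = k
      · rw [if_pos e1] at hp
        rw [if_pos e2] at hq
        exact hc p q hp hq (e1.trans e2.symm)
      · exact absurd (if_neg e2) hq
    · exact absurd (if_neg e1) hp
  set g := theta K σ r f with hg
  have h1 : coeff (Finsupp.weight (psiE r row col) mm) (psi K r row col g) = coeff mm g := by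
    conv_lhs => rw [g.as_sum, map_sum, coeff_sum]
    rw [Finset.sum_eq_single mm]
    · rw [psi_monomial, coeff_monomial, if_pos rfl]
    · intro x hx hne
      rw [psi_monomial, coeff_monomial, if_neg]
      intro hw
      have hR : ∀ k, rowM v (slice x k) = rowM v (slice mm k) := by
        intro k; funext i
        rw [← weight_inl h, ← weight_inl h, hw]
      have hC : ∀ k, colM v (slice x k) = colM v (slice mm k) := by
        intro k; funext i
        rw [← weight_inr h, ← weight_inr h, hw]
      have hmem := total_mem_support f x (mem_support_iff.1 hx)
      rcases anti_min_sum h hd hanti hR hC Finset.univ with e | e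
      · apply hne
        ext ⟨k, p⟩
        have := DFunLike.congr_fun (e k (Finset.mem_univ k)) p
        rwa [slice_apply, slice_apply] at this
      · rw [hsum] at e
        by_cases e2 : ∑ k, slice x k = m
        · rw [e2] at e; exact tord.irrefl _ e
        · exact tord.irrefl _ (tord.trans e (hm.2 _ hmem e2))
    · intro hx
      rw [psi_monomial, notMem_support_iff.1 hx]; simp
  rw [h0, coeff_zero, hg, hmm, coeff_theta] at h1
  exact (mem_support_iff.1 hm.1) h1.symm

theorem det_mul_eq_zero {R : Type*} [CommRing R] (A : Matrix (Fin (r + 1)) (Fin r) R)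
    (B : Matrix (Fin r) (Fin (r + 1)) R) : (A * B).det = 0 := by
  have : A * B = (Matrix.of fun i => (Fin.snoc (A i) 0 : Fin (r + 1) → R)) *
      (Matrix.of fun k j => (Fin.snoc (fun k => B k j) 0 : Fin (r + 1) → R) k) := by
    ext i j
    simp [Matrix.mul_apply, Fin.sum_univ_castSucc]
  rw [this, Matrix.det_mul, Matrix.det_eq_zero_of_column_eq_zero (Fin.last r), zero_mul]
  intro i
  simp

theorem psi_theta_minor {v : Fin a → Fin b → σ} {row : σ → Fin a} {col : σ → Fin b}
    (h : Coord v row col) (rs : Fin (r + 1) → Fin a) (cs : Fin (r + 1) → Fin b) :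
    psi K r row col (theta K σ r
      (Matrix.of fun i j => (X (v (rs i) (cs j)) : MvPolynomial σ K)).det) = 0 := by
  rw [AlgHom.map_det, AlgHom.map_det]
  rw [← det_mul_eq_zero
    (Matrix.of fun i k => (X (Sum.inl (rs i, k)) :
      MvPolynomial ((Fin a × Fin r) ⊕ (Fin r × Fin b)) K))
    (Matrix.of fun k j => X (Sum.inr (k, cs j)))]
  congr 1
  ext1 i j
  have hX : ∀ k : Fin r, psi K r row col (X (k, v (rs i) (cs j))) =
      X (Sum.inl (rs i, k)) * X (Sum.inr (k, cs j)) := by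
    intro k
    rw [psi, aeval_X, X, X, monomial_mul, psiE, h.hr, h.hc, one_mul]
  have hT : theta K σ r (X (v (rs i) (cs j))) = ∑ k, X (k, v (rs i) (cs j)) := by
    rw [theta, aeval_X]
  simp only [Matrix.mul_apply, AlgHom.mapMatrix_apply, Matrix.map_apply, Matrix.of_apply, hT,
    map_sum, hX]

theorem core {v : Fin a → Fin b → σ} {row : σ → Fin a} {col : σ → Fin b}
    (h : Coord v row col) (hd : IsDiagonalFor K tord v) (t : ℕ) :
    initialIdeal tord (Ideal.span {d | ∃ (rs : Fin t → Fin a) (cs : Fin t → Fin b),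
      StrictMono rs ∧ StrictMono cs ∧
        d = (Matrix.of fun i j => (X (v (rs i) (cs j)) : MvPolynomial σ K)).det}) =
      Ideal.span {g | ∃ (rs : Fin t → Fin a) (cs : Fin t → Fin b),
        StrictMono rs ∧ StrictMono cs ∧
        g = monomial (∑ i : Fin t, Finsupp.single (v (rs i) (cs i)) 1) (1 : K)} := by
  apply le_antisymm
  · rw [initialIdeal, Ideal.span_le]
    rintro _ ⟨f, hf, m, hm, rfl⟩
    have chain : ∀ (g : Fin t → σ), (∀ i, m (g i) ≠ 0) →
        (∀ i j, i < j → row (g i) < row (g j) ∧ col (g i) < col (g j)) →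
        monomial m (1 : K) ∈ Ideal.span {g | ∃ (rs : Fin t → Fin a) (cs : Fin t → Fin b),
          StrictMono rs ∧ StrictMono cs ∧
          g = monomial (∑ i : Fin t, Finsupp.single (v (rs i) (cs i)) 1) (1 : K)} := by
      intro g hg hlt
      have hinj : Function.Injective g := by
        intro i j e
        rcases lt_trichotomy i j with h' | h' | h'
        · have := (hlt i j h').1; rw [e] at this; exact absurd this (lt_irrefl _)
        · exact h'
        · have := (hlt j i h').1; rw [e] at this; exact absurd this (lt_irrefl _)
      have hle : ∑ i : Fin t, Finsupp.single (v (row (g i)) (col (g i))) 1 ≤ m := by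
        intro p
        simp only [h.hv]
        rw [Finsupp.finsetSum_apply]
        simp only [Finsupp.single_apply]
        by_cases hp : ∃ i, g i = p
        · obtain ⟨i, rfl⟩ := hp
          simp only [hinj.eq_iff]
          simp
          have := hg i
          omega
        · rw [Finset.sum_eq_zero]
          · exact Nat.zero_le _
          · intro i _
            exact if_neg fun e => hp ⟨i, e⟩
      obtain ⟨z, hz⟩ := exists_add_of_le hle
      rw [hz, show (1 : K) = 1 * 1 by simp, ← monomial_mul]
      apply Ideal.mul_mem_right
      exact Ideal.subset_span ⟨_, _, fun i j hij => (hlt i j hij).1,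
        fun i j hij => (hlt i j hij).2, by simp⟩
    cases t with
    | zero => exact chain (fun i => i.elim0) (fun i => i.elim0) (fun i => i.elim0)
    | succ r =>
      rcases chain_or_color (fun p q : σ => row p < row q ∧ col p < col q)
        (fun x y z h1 h2 => ⟨h1.1.trans h2.1, h1.2.trans h2.2⟩) r m.support with
        ⟨g, hg, hlt⟩ | ⟨c, hc1, hc2⟩
      · exact chain g (fun i => Finsupp.mem_support_iff.1 (hg i)) hlt
      · exfalso
        cases r with
        | zero =>
          have hm0 : m = 0 := by
            ext p
            by_contra hp
            exact absurd (hc1 p (Finsupp.mem_support_iff.2 hp)) (by omega)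
          have : Ideal.span {d | ∃ (rs : Fin (0 + 1) → Fin a) (cs : Fin (0 + 1) → Fin b),
              StrictMono rs ∧ StrictMono cs ∧
              d = (Matrix.of fun i j => (X (v (rs i) (cs j)) : MvPolynomial σ K)).det} ≤
              RingHom.ker (constantCoeff (σ := σ) (R := K)) := by
            rw [Ideal.span_le]
            rintro _ ⟨rs, cs, -, -, rfl⟩
            simp [RingHom.mem_ker]
          have h0 := this hf
          rw [RingHom.mem_ker, constantCoeff_eq] at h0
          subst hm0
          exact mem_support_iff.1 hm.1 h0
        | succ r =>
          let c' : σ → Fin (r + 1) := fun p => Fin.ofNat (r + 1) (c p)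
          refine psi_theta_ne (r := r + 1) h hd hm c' ?_ ?_
          · intro p q hp hq e
            have h1 := Finsupp.mem_support_iff.2 hp
            have h2 := Finsupp.mem_support_iff.2 hq
            refine hc2 p h1 q h2 ?_
            have := congrArg Fin.val e
            simpa [c', Fin.ofNat, Nat.mod_eq_of_lt (hc1 p h1), Nat.mod_eq_of_lt (hc1 q h2)]
              using this
          · have : Ideal.span {d | ∃ (rs : Fin (r + 1 + 1) → Fin a) (cs : Fin (r + 1 + 1) → Fin b),
                StrictMono rs ∧ StrictMono cs ∧
                d = (Matrix.of fun i j => (X (v (rs i) (cs j)) : MvPolynomial σ K)).det} ≤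
                RingHom.ker ((psi K (r + 1) row col).comp (theta K σ (r + 1))) := by
              rw [Ideal.span_le]
              rintro _ ⟨rs, cs, -, -, rfl⟩
              exact psi_theta_minor h rs cs
            exact this hf
  · rw [Ideal.span_le]
    rintro _ ⟨rs, cs, hrs, hcs, rfl⟩
    refine Ideal.subset_span ⟨_, Ideal.subset_span ⟨rs, cs, hrs, hcs, rfl⟩, _, ?_, rfl⟩
    rcases Nat.eq_zero_or_pos t with rfl | ht
    · refine ⟨by simp, ?_⟩
      intro m' hm' hne
      exfalso
      apply hne
      simpa [mem_support_iff, coeff_one, eq_comm] using hm'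
    · exact hd t rs cs hrs hcs ht

end Helpers

theorem determinantal_initial_ideal (K : Type*) [Field K] (m n t : ℕ)
    (hm : 0 < m) (hn : 0 < n)
    (tord : TermOrder (Fin 1 × Fin m × Fin n))
    (hdiag : IsDiagonalFor K tord (fun i k => varH 1 m n hn i k)) :
    initialIdeal tord (Ideal.span (minorsSet t m (1 * n) (Hmat K 1 m n hn))) =
      Ideal.span {g | ∃ (rs : Fin t → Fin m) (cs : Fin t → Fin (1 * n)),
        StrictMono rs ∧ StrictMono cs ∧
        g = monomial (∑ i : Fin t, Finsupp.single (varH 1 m n hn (rs i) (cs i)) 1) (1 : K)} := by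

  have h : Coord (fun i k => varH 1 m n hn i k) (fun p => p.2.1)
      (fun p => (⟨p.2.2.val, by have := p.2.2.isLt; omega⟩ : Fin (1 * n))) := by
    refine ⟨fun i j => rfl, fun i j => ?_, fun p => ?_⟩
    · have := j.isLt
      ext
      simp only [varH]
      exact Nat.mod_eq_of_lt (by omega)
    · obtain ⟨p0, i, j⟩ := p
      have := j.isLt
      simp only [varH, Prod.mk.injEq]
      refine ⟨Subsingleton.elim _ _, trivial, ?_⟩
      ext
      exact Nat.mod_eq_of_lt this
  exact core h hdiag t

end
end

section
/- There exists a diagonal term order for any double determinantal configuration: the graded lexicographic order induced by the reading order on the entries of the vertical concatenation V (reading the entries of V row by row, left to right, top to bottom) is a term order under which the leading term of the determinant of every square submatrix of H and of every square submatrix of V is the product of its main diagonal entries. -/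
/-! Statement 15: the graded lexicographic order induced by the reading order
on the entries of the vertical concatenation V (row by row, left to right,
top to bottom) is a term order, and it is diagonal for both H and V. -/

open MvPolynomial

noncomputable section

/-- The reading position of the variable `x^q_{i,j}` in the row-by-row reading of the
vertical concatenation `V`: rows of `V` are indexed by `(q, i)` ordered by `q` then `i`. -/
def readPos (m n : ℕ) (v : Fin r × Fin m × Fin n) : ℕ :=
  (v.1.val * m + v.2.1.val) * n + v.2.2.val

/-- Total degree of an exponent vector. -/
def totalDeg {σ : Type*} (a : σ →₀ ℕ) : ℕ := a.sum fun _ e => e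

/-- The graded lexicographic order induced by the reading order on `V`:
compare total degrees first; for equal degrees, compare lexicographically, where a
variable appearing earlier in the reading of `V` is more significant, and at the
first (most significant) variable where the exponents differ, the monomial with the
larger exponent is larger. -/
def grlexLt (r m n : ℕ) (a b : (Fin r × Fin m × Fin n) →₀ ℕ) : Prop :=
  totalDeg a < totalDeg b ∨
    (totalDeg a = totalDeg b ∧ ∃ v, (∀ w, readPos m n w < readPos m n v → a w = b w) ∧ a v < b v)

lemma totalDeg_eq {σ : Type*} (a : σ →₀ ℕ) : totalDeg a = a.degree := rfl

lemma readPos_inj (r m n : ℕ) : Function.Injective (readPos (r := r) m n) := by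
  rintro ⟨q, i, j⟩ ⟨q', i', j'⟩ h
  simp only [readPos] at h
  have key : ∀ (N a b a' b' : ℕ), b < N → b' < N → a * N + b = a' * N + b' → a = a' ∧ b = b' := by
    intro N a b a' b' hb hb' h
    have hN : 0 < N := by omega
    have h1 : (b + N * a) / N = (b' + N * a') / N := by
      rw [show b + N * a = b' + N * a' by linarith [mul_comm N a, mul_comm N a']]
    rw [Nat.add_mul_div_left _ _ hN, Nat.add_mul_div_left _ _ hN, Nat.div_eq_of_lt hb,
      Nat.div_eq_of_lt hb'] at h1
    have : a = a' := by omega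
    subst this
    exact ⟨rfl, by omega⟩
  obtain ⟨h1, h2⟩ := key _ _ _ _ _ j.isLt j'.isLt h
  obtain ⟨h3, h4⟩ := key _ _ _ _ _ i.isLt i'.isLt h1
  simp [Fin.ext_iff, h2, h3, h4]

def grlexOrder (r m n : ℕ) : TermOrder (Fin r × Fin m × Fin n) where
  lt := grlexLt r m n
  trans := by
    rintro a b c (h | ⟨h, v, hv, hv'⟩) (h2 | ⟨h2, w, hw, hw'⟩)
    · exact Or.inl (by omega)
    · exact Or.inl (by omega)
    · exact Or.inl (by omega)
    · refine Or.inr ⟨by omega, ?_⟩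
      rcases lt_trichotomy (readPos m n v) (readPos m n w) with hl | hl | hl
      · exact ⟨v, fun u hu => (hv u hu).trans (hw u (by omega)), (hw v hl) ▸ hv'⟩
      · have := readPos_inj r m n hl
        subst this
        exact ⟨v, fun u hu => (hv u hu).trans (hw u hu), hv'.trans hw'⟩
      · exact ⟨w, fun u hu => (hv u (by omega)).trans (hw u hu), (hv w hl) ▸ hw'⟩
  irrefl := by
    rintro a (h | ⟨h, v, hv, hv'⟩) <;> omega
  total := by
    intro a b hab
    rcases lt_trichotomy (totalDeg a) (totalDeg b) with hl | hl | hl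
    · exact Or.inl (Or.inl hl)
    · have hne : (Finset.univ.filter fun v => a v ≠ b v).Nonempty := by
        obtain ⟨v, hv⟩ := Finsupp.ne_iff.mp hab
        exact ⟨v, by simpa using hv⟩
      obtain ⟨v, hv, hmin⟩ := Finset.exists_min_image _ (readPos m n) hne
      simp only [Finset.mem_filter, Finset.mem_univ, true_and] at hv hmin
      have heq : ∀ w, readPos m n w < readPos m n v → a w = b w := by
        intro w hw
        by_contra hc
        have := hmin w hc
        omega
      rcases lt_or_gt_of_ne hv with h | h
      · exact Or.inl (Or.inr ⟨hl, v, heq, h⟩)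
      · exact Or.inr (Or.inr ⟨hl.symm, v, fun w hw => (heq w hw).symm, h⟩)
    · exact Or.inr (Or.inl hl)
  zero_lt := by
    intro a ha
    refine Or.inl ?_
    rw [totalDeg_eq, totalDeg_eq, map_zero, Nat.pos_iff_ne_zero, Ne, Finsupp.degree_eq_zero_iff]
    exact ha
  add_right := by
    rintro a b c (h | ⟨h, v, hv, hv'⟩)
    · refine Or.inl ?_
      simp only [totalDeg_eq, map_add] at *
      omega
    · refine Or.inr ⟨?_, v, fun w hw => ?_, ?_⟩
      · simp only [totalDeg_eq, map_add] at *
        omega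
      · simp [hv w hw]
      · simpa using hv'

def permMono {σ : Type*} {t : ℕ} (f : Fin t → Fin t → σ) (p : Equiv.Perm (Fin t)) : σ →₀ ℕ :=
  ∑ i : Fin t, Finsupp.single (f (p i) i) 1

lemma permMono_apply {σ : Type*} {t : ℕ} (f : Fin t → Fin t → σ)
    (hf : ∀ a b a' b', f a b = f a' b' → a = a' ∧ b = b') (p : Equiv.Perm (Fin t)) (a b : Fin t) :
    permMono f p (f a b) = if p b = a then 1 else 0 := by
  classical
  rw [permMono, Finsupp.finsetSum_apply, Finset.sum_eq_single b]
  · rw [Finsupp.single_apply]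
    refine if_congr ⟨fun h => (hf _ _ _ _ h).1, fun h => by rw [h]⟩ rfl rfl
  · intro i _ hi
    rw [Finsupp.single_apply, if_neg]
    exact fun h => hi (hf _ _ _ _ h).2
  · simp

lemma permMono_ne {σ : Type*} {t : ℕ} (f : Fin t → Fin t → σ) (p : Equiv.Perm (Fin t)) (w : σ)
    (h : permMono f p w ≠ 0) : ∃ i, w = f (p i) i := by
  classical
  rw [permMono, Finsupp.finsetSum_apply] at h
  obtain ⟨i, _, hi⟩ := Finset.exists_ne_zero_of_sum_ne_zero h
  rw [Finsupp.single_apply] at hi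
  refine ⟨i, ?_⟩
  by_contra hc
  exact hi (if_neg (fun h => hc h.symm))

lemma permMono_inj {σ : Type*} {t : ℕ} (f : Fin t → Fin t → σ)
    (hf : ∀ a b a' b', f a b = f a' b' → a = a' ∧ b = b') : Function.Injective (permMono f) := by
  intro p q h
  ext1 i
  have h1 := permMono_apply f hf p (p i) i
  rw [h, permMono_apply f hf, if_pos rfl] at h1
  by_contra hc
  rw [if_neg (fun h => hc h.symm)] at h1
  omega

lemma totalDeg_permMono {σ : Type*} {t : ℕ} (f : Fin t → Fin t → σ) (p : Equiv.Perm (Fin t)) :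
    totalDeg (permMono f p) = t := by
  rw [totalDeg_eq, permMono, map_sum]
  simp

lemma det_eq_permMono (K : Type*) [Field K] {σ : Type*} {t : ℕ} (f : Fin t → Fin t → σ) :
    (Matrix.of fun i j => (X (f i j) : MvPolynomial σ K)).det =
      ∑ p : Equiv.Perm (Fin t), monomial (permMono f p) (((Equiv.Perm.sign p : ℤ) : K)) := by
  rw [Matrix.det_apply']
  refine Finset.sum_congr rfl fun p _ => ?_
  have : (∏ i, (Matrix.of fun i j => (X (f i j) : MvPolynomial σ K)) (p i) i)
      = monomial (permMono f p) 1 := by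
    simp only [Matrix.of_apply, X, permMono]
    rw [monomial_sum_one]
  rw [this, ← map_intCast (C : K →+* MvPolynomial σ K), C_mul_monomial, mul_one]

lemma diag_of_mono (K : Type*) [Field K] (r m n a b : ℕ) (v : Fin a → Fin b → Fin r × Fin m × Fin n)
    (h1 : ∀ i k k', k < k' → readPos m n (v i k) < readPos m n (v i k'))
    (h2 : ∀ i i' k, i < i' → readPos m n (v i k) < readPos m n (v i' k))
    (hv : ∀ i k i' k', v i k = v i' k' → i = i' ∧ k = k') :
    IsDiagonalFor K (grlexOrder r m n) v := by
  classical
  intro t rs cs hr hc _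
  set f : Fin t → Fin t → Fin r × Fin m × Fin n := fun i j => v (rs i) (cs j) with hfdef
  have hf : ∀ a b a' b', f a b = f a' b' → a = a' ∧ b = b' := by
    intro a b a' b' h
    have := hv _ _ _ _ h
    exact ⟨hr.injective this.1, hc.injective this.2⟩
  have hdet := det_eq_permMono K f
  change IsLeadMono _ ((Matrix.of fun i j => (X (f i j) : MvPolynomial _ K)).det) (permMono f 1)
  rw [hdet]
  constructor
  · rw [mem_support_iff, coeff_sum, Finset.sum_eq_single 1]
    · simp
    · intro p _ hp
      rw [coeff_monomial, if_neg]
      exact fun h => hp (permMono_inj f hf h)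
    · simp
  · intro m' hm' hne
    rw [mem_support_iff, coeff_sum] at hm'
    obtain ⟨p, _, hp⟩ := Finset.exists_ne_zero_of_sum_ne_zero hm'
    have hpm : permMono f p = m' := by
      by_contra hcon
      exact hp (by rw [coeff_monomial, if_neg hcon])
    subst hpm
    rcases (grlexOrder r m n).total _ _ hne with h | h
    · exact h
    · exfalso
      rcases h with h | ⟨_, w, hw, hlt⟩
      · rw [totalDeg_permMono, totalDeg_permMono] at h
        omega
      · obtain ⟨i, rfl⟩ := permMono_ne f p w (by omega)
        rw [permMono_apply f hf, permMono_apply f hf, if_pos rfl] at hlt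
        have hi : i ≠ p i := by
          intro h
          rw [if_pos (by simpa using h)] at hlt
          omega
        rcases lt_or_gt_of_ne hi with h | h
        · have := hw (f i i) (h2 _ _ _ (hr h))
          rw [permMono_apply f hf, permMono_apply f hf, if_pos (Equiv.Perm.one_apply _), if_neg hi.symm] at this
          omega
        · have := hw (f (p i) (p i)) (h1 _ _ _ (hc h))
          rw [permMono_apply f hf, permMono_apply f hf, if_pos (Equiv.Perm.one_apply _),
            if_neg (fun h => hi (p.injective h).symm)] at this
          omega

theorem grlex_reading_order_is_diagonal (K : Type*) [Field K] (r m n : ℕ)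
    (hm : 0 < m) (hn : 0 < n) :
    ∃ tord : TermOrder (Fin r × Fin m × Fin n),
      tord.lt = grlexLt r m n ∧ IsDiagonalTermOrder K r m n hm hn tord := by
  refine ⟨grlexOrder r m n, rfl, ?_, ?_⟩
  · apply diag_of_mono
    · intro i k k' h
      simp only [readPos, varH]
      have h : k.val < k'.val := h
      have e1 := Nat.div_add_mod k.val n
      have e2 := Nat.div_add_mod k'.val n
      have l1 := Nat.mod_lt k.val hn
      have hle : k.val / n ≤ k'.val / n := Nat.div_le_div_right h.le
      rcases hle.eq_or_lt with he | hl
      · rw [he] at e1 ⊢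
        omega
      · have : (k.val / n + 1) * m ≤ (k'.val / n) * m := Nat.mul_le_mul_right _ hl
        have h3 : (k.val / n * m + i.val + 1) * n ≤ (k'.val / n * m + i.val) * n :=
          Nat.mul_le_mul_right _ (by linarith)
        rw [Nat.succ_mul] at h3
        omega
    · intro i i' k h
      simp only [readPos, varH]
      have h : i.val < i'.val := h
      gcongr
    · intro i k i' k' h
      simp only [varH, Prod.mk.injEq, Fin.mk.injEq] at h
      refine ⟨h.2.1, Fin.ext ?_⟩
      rw [← Nat.div_add_mod k.val n, ← Nat.div_add_mod k'.val n, h.1, h.2.2]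
  · have e : ∀ (k : Fin (r * m)) (j : Fin n),
        readPos m n (varV r m n hm k j) = k.val * n + j.val := by
      intro k j
      simp only [readPos, varV]
      rw [mul_comm (k.val / m) m, Nat.div_add_mod]
    apply diag_of_mono
    · intro i k k' h
      rw [e, e]
      have h : k.val < k'.val := h
      omega
    · intro i i' k h
      rw [e, e]
      have h : i.val < i'.val := h
      gcongr
    · intro i k i' k' h
      simp only [varV, Prod.mk.injEq, Fin.mk.injEq] at h
      refine ⟨Fin.ext ?_, h.2.2⟩
      rw [← Nat.div_add_mod i.val m, ← Nat.div_add_mod i'.val m, h.1, h.2.1]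

end
end
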